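/- Let 0<Δ<1 and let y ∈ C²(B₁∖{0}; ℝ³) be Lipschitz on B₁ and satisfy (Dy)ᵀDy = g_Δ on B₁∖{0}. Then Σ_{i=1}^{3} det D²y_i(x) = 0 for every x ∈ B₁∖{0}, and for every Φ ∈ C²_c(B₁; ℝ), ∫_{B₁} [ (y_{,1}·y_{,2}) Φ_{,12} − (1/2)|y_{,1}|² Φ_{,22} − (1/2)|y_{,2}|² Φ_{,11} ] dL² = πΔ² Φ(0); i.e. the distributional Hessian determinant sum of y equals πΔ² δ₀. -/

import Mathlib

open MeasureTheory Metric Real Filter Matrix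
open scoped ENNReal Topology

noncomputable section

/-- The plane `ℝ²` with the Euclidean norm. -/
abbrev E2 : Type := EuclideanSpace ℝ (Fin 2)
/-- The space `ℝ³` with the Euclidean norm. -/
abbrev E3 : Type := EuclideanSpace ℝ (Fin 3)

/-- The `i`-th standard basis vector of `ℝ²`. -/
def e2 (i : Fin 2) : E2 := EuclideanSpace.single i 1

/-- Partial derivative in the direction of the `i`-th coordinate. -/
def pd (i : Fin 2) (f : E2 → ℝ) (x : E2) : ℝ := fderiv ℝ f x (e2 i)

/-- Hessian matrix of a scalar function on `ℝ²`. -/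
def hess (f : E2 → ℝ) (x : E2) : Matrix (Fin 2) (Fin 2) ℝ :=
  Matrix.of fun i j => pd i (pd j f) x

/-- Derivative matrix `Dy ∈ ℝ^{3×2}` of a map `y : ℝ² → ℝ³`. -/
def Dmat (y : E2 → E3) (x : E2) : Matrix (Fin 3) (Fin 2) ℝ :=
  Matrix.of fun i j => pd j (fun z => y z i) x

/-- Induced metric `g_y = (Dy)ᵀ Dy`. -/
def gmet (y : E2 → E3) (x : E2) : Matrix (Fin 2) (Fin 2) ℝ :=
  (Dmat y x)ᵀ * Dmat y x

/-- The rotated vector `x⊥ = (-x₂, x₁)`. -/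
def perpVec (x : E2) : Fin 2 → ℝ := ![-(x 1), x 0]

/-- The unit tangent `x̂⊥ = (-x₂, x₁)/|x|`. -/
def xperpUnit (x : E2) : Fin 2 → ℝ := fun i => perpVec x i / ‖x‖

/-- The reference (cone) metric `g_Δ = Id - Δ² x̂⊥ ⊗ x̂⊥`. -/
def gDelta (Δ : ℝ) (x : E2) : Matrix (Fin 2) (Fin 2) ℝ :=
  1 - Matrix.of fun i j => (Δ ^ 2 / ‖x‖ ^ 2) * perpVec x i * perpVec x j

/-- Squared Frobenius norm of a matrix. -/
def frob2 {m n : Type*} [Fintype m] [Fintype n] (A : Matrix m n ℝ) : ℝ :=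
  ∑ i, ∑ j, (A i j) ^ 2

/-- `|D²y|²`: the sum of the squared Frobenius norms of the Hessians of the components. -/
def hessNormSq (y : E2 → E3) (x : E2) : ℝ :=
  ∑ i : Fin 3, frob2 (hess (fun z => y z i) x)

/-- The free elastic energy `I_{h,Δ}(y)`. -/
def energy (h Δ : ℝ) (y : E2 → E3) : ℝ :=
  ∫ x in ball (0 : E2) 1, (frob2 (gmet y x - gDelta Δ x) + h ^ 2 * hessNormSq y x)

/-- The singular cone `y^Δ(x) = √(1-Δ²)·(x,0) + Δ|x| e₃`. -/
def coneMap (Δ : ℝ) (x : E2) : E3 :=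
  (WithLp.equiv 2 (Fin 3 → ℝ)).symm
    ![Real.sqrt (1 - Δ ^ 2) * x 0, Real.sqrt (1 - Δ ^ 2) * x 1, Δ * ‖x‖]


lemma pd_contDiff {f : E2 → ℝ} {n : ℕ} (hf : ContDiff ℝ (n + 1 : ℕ) f) (i : Fin 2) :
    ContDiff ℝ n (pd i f) := by
  unfold pd
  exact (hf.fderiv_right (m := n) (by norm_cast)).clm_apply contDiff_const

lemma pd_cont {f : E2 → ℝ} (hf : ContDiff ℝ 1 f) (i : Fin 2) : Continuous (pd i f) := by
  have := pd_contDiff (n := 0) (f := f) (by simpa using hf) i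
  exact this.continuous

lemma pd_c1 {f : E2 → ℝ} (hf : ContDiff ℝ 2 f) (i : Fin 2) : ContDiff ℝ 1 (pd i f) := by
  have := pd_contDiff (n := 1) (f := f) (by simpa using hf) i
  simpa using this

lemma pd_tsupport (f : E2 → ℝ) (i : Fin 2) : tsupport (pd i f) ⊆ tsupport f := by
  unfold pd
  exact tsupport_fderiv_apply_subset ℝ (e2 i)

lemma pd_cs {f : E2 → ℝ} (hf : HasCompactSupport f) (i : Fin 2) : HasCompactSupport (pd i f) :=
  hf.of_isClosed_subset (isClosed_tsupport _) (pd_tsupport f i)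

lemma pd_symm {f : E2 → ℝ} (hf : ContDiff ℝ 2 f) (i j : Fin 2) (x : E2) :
    pd i (pd j f) x = pd j (pd i f) x := by
  have h := (hf.contDiffAt (x := x)).isSymmSndFDerivAt (by simp)
  have hd : DifferentiableAt ℝ (fderiv ℝ f) x :=
    ((hf.fderiv_right (m := 1) (by norm_num)).differentiable (by norm_num)) x
  have key : ∀ a b : Fin 2, pd a (pd b f) x = fderiv ℝ (fderiv ℝ f) x (e2 a) (e2 b) := by
    intro a b
    unfold pd
    rw [fderiv_clm_apply hd (differentiableAt_const _)]
    simp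
  rw [key, key]
  exact h.eq _ _

lemma ibp {f g : E2 → ℝ} (hf : ContDiff ℝ 1 f) (hg : ContDiff ℝ 1 g) (hc : HasCompactSupport g)
    (i : Fin 2) : ∫ x, f x * pd i g x = - ∫ x, pd i f x * g x := by
  unfold pd
  apply integral_mul_fderiv_eq_neg_fderiv_mul_of_integrable
  · exact ((pd_cont hf i).mul hg.continuous).integrable_of_hasCompactSupport hc.mul_left
  · exact (hf.continuous.mul (pd_cont hg i)).integrable_of_hasCompactSupport (pd_cs hc i).mul_left
  · exact (hf.continuous.mul hg.continuous).integrable_of_hasCompactSupport hc.mul_left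
  · exact fun x _ => hf.differentiable (by norm_num) x
  · exact fun x _ => hg.differentiable (by norm_num) x

lemma int_pd {g : E2 → ℝ} (hg : ContDiff ℝ 1 g) (hc : HasCompactSupport g)
    (i : Fin 2) : ∫ x, pd i g x = 0 := by
  have := ibp (f := fun _ => 1) contDiff_const hg hc i
  simpa [pd] using this

lemma pd_mul {f g : E2 → ℝ} (hf : ContDiff ℝ 1 f) (hg : ContDiff ℝ 1 g) (i : Fin 2) (x : E2) :
    pd i (fun z => f z * g z) x = pd i f x * g x + f x * pd i g x := by
  unfold pd
  rw [fderiv_fun_mul (hf.differentiable (by norm_num) x) (hg.differentiable (by norm_num) x)]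
  simp; ring

lemma pd_lineDeriv {f : E2 → ℝ} (hf : ContDiff ℝ 1 f) (i : Fin 2) (x : E2) :
    lineDeriv ℝ f x (e2 i) = pd i f x :=
  (hf.differentiable (by norm_num) x).lineDeriv_eq_fderiv

lemma pd_shift {f : E2 → ℝ} (i : Fin 2) (x a : E2) :
    pd i (fun z => f (z + a)) x = pd i f (x + a) := by
  unfold pd
  rw [fderiv_comp_add_right]

lemma jac {v w : E2 → ℝ} (hv : ContDiff ℝ 1 v) (hw : ContDiff ℝ 1 w)
    (cv : HasCompactSupport v) (cw : HasCompactSupport w) (i j : Fin 2) :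
    ∫ x, pd j v x * pd i w x = ∫ x, pd i v x * pd j w x := by
  obtain ⟨C, hC⟩ := hw.lipschitzWith_of_hasCompactSupport cw (by norm_num)
  obtain ⟨D, hD⟩ := hv.lipschitzWith_of_hasCompactSupport cv (by norm_num)
  have iv := (pd_cont hv j).integrable_of_hasCompactSupport (μ := volume) (pd_cs cv j)
  have iw := (pd_cont hw j).integrable_of_hasCompactSupport (μ := volume) (pd_cs cw j)
  have A := hC.integral_inv_smul_sub_mul_tendsto_integral_lineDeriv_mul iv (e2 i)
  have B := hD.integral_inv_smul_sub_mul_tendsto_integral_lineDeriv_mul iw (- e2 i)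
  have hA : ∫ x, lineDeriv ℝ w x (e2 i) * pd j v x = ∫ x, pd j v x * pd i w x := by
    congr 1; ext x; rw [pd_lineDeriv hw]; ring
  have hB : ∫ x, lineDeriv ℝ v x (- e2 i) * pd j w x = - ∫ x, pd i v x * pd j w x := by
    rw [← integral_neg]; congr 1; ext x; rw [lineDeriv_neg, pd_lineDeriv hv]; ring
  rw [hA] at A
  rw [hB] at B
  have key : ∀ t : ℝ, ∫ x, (t⁻¹ • (w (x + t • e2 i) - w x)) * pd j v x
      = - ∫ x, (t⁻¹ • (v (x + t • - e2 i) - v x)) * pd j w x := by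
    intro t
    set a := t • e2 i with ha
    have ha' : t • - e2 i = -a := by simp [ha]
    rw [ha']
    have hva : ContDiff ℝ 1 (fun z => v (z + -a)) := by fun_prop
    have hwa : ContDiff ℝ 1 (fun z => w (z + a)) := by fun_prop
    have cwa : HasCompactSupport (fun z => w (z + a)) := cw.comp_homeomorph (Homeomorph.addRight a)
    have cva : HasCompactSupport (fun z => v (z + -a)) :=
      cv.comp_homeomorph (Homeomorph.addRight (-a))
    have e1 : ∫ x, w (x + a) * pd j v x = ∫ x, w x * pd j v (x + -a) := by
      have := integral_add_right_eq_self (μ := (volume : Measure E2))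
        (fun x => w x * pd j v (x + -a)) a
      rw [← this]; simp
    have e2' := ibp (f := w) hw hva cva j
    have e3 := ibp (f := w) hw hv cv j
    simp only [pd_shift] at e2'
    have i1 : Integrable (fun x => w (x + a) * pd j v x) :=
      (hwa.continuous.mul (pd_cont hv j)).integrable_of_hasCompactSupport cwa.mul_right
    have i2 : Integrable (fun x => w x * pd j v x) :=
      (hw.continuous.mul (pd_cont hv j)).integrable_of_hasCompactSupport cw.mul_right
    have i3 : Integrable (fun x => pd j w x * v (x + -a)) :=
      ((pd_cont hw j).mul hva.continuous).integrable_of_hasCompactSupport cva.mul_left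
    have i4 : Integrable (fun x => pd j w x * v x) :=
      ((pd_cont hw j).mul hv.continuous).integrable_of_hasCompactSupport cv.mul_left
    have l : ∫ x, (t⁻¹ • (w (x + a) - w x)) * pd j v x
        = t⁻¹ * ((∫ x, w (x + a) * pd j v x) - ∫ x, w x * pd j v x) := by
      rw [← integral_sub i1 i2, ← integral_const_mul]
      congr 1; ext x; simp; ring
    have r : ∫ x, (t⁻¹ • (v (x + -a) - v x)) * pd j w x
        = t⁻¹ * ((∫ x, pd j w x * v (x + -a)) - ∫ x, pd j w x * v x) := by
      rw [← integral_sub i3 i4, ← integral_const_mul]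
      congr 1; ext x; simp; ring
    rw [l, r, e1, e2', e3]; ring
  simp_rw [key] at A
  have := tendsto_nhds_unique A B.neg
  simpa using this

lemma lin3 {α : Type*} [MeasurableSpace α] {μ : Measure α} {f g h : α → ℝ} (F : α → ℝ) (a b c : ℝ)
    (hf : Integrable f μ) (hg : Integrable g μ) (hh : Integrable h μ)
    (hF : ∀ x, F x = a * f x + b * g x + c * h x) :
    ∫ x, F x ∂μ = a * (∫ x, f x ∂μ) + b * (∫ x, g x ∂μ) + c * ∫ x, h x ∂μ := by
  have e : F = fun x => a * f x + b * g x + c * h x := funext hF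
  have hf' := hf.const_mul a
  have hg' := hg.const_mul b
  have hh' := hh.const_mul c
  have hfg : Integrable (fun x => a * f x + b * g x) μ := hf'.add hg'
  rw [e, integral_add hfg hh', integral_add hf' hg', integral_const_mul, integral_const_mul,
    integral_const_mul]

/-- the weak form of the Hessian determinant -/
lemma weakdet {u φ : E2 → ℝ} (hu : ContDiff ℝ 2 u) (cu : HasCompactSupport u)
    (hφ : ContDiff ℝ 2 φ) (cφ : HasCompactSupport φ) :
    ∫ x, (pd 0 u x * pd 1 u x * hess φ x 0 1 - (1/2) * (pd 0 u x * pd 0 u x) * hess φ x 1 1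
      - (1/2) * (pd 1 u x * pd 1 u x) * hess φ x 0 0) = ∫ x, φ x * (hess u x).det := by
  have u0 := pd_c1 hu 0
  have u1 := pd_c1 hu 1
  have p0 := pd_c1 hφ 0
  have p1 := pd_c1 hφ 1
  have hφ1 : ContDiff ℝ 1 φ := hφ.of_le (by norm_num)
  have a := ibp (f := fun z => pd 0 u z * pd 1 u z) (u0.mul u1) p0 (pd_cs cφ 0) 1
  have b := ibp (f := fun z => pd 0 u z * pd 0 u z) (u0.mul u0) p1 (pd_cs cφ 1) 1
  have c := ibp (f := fun z => pd 1 u z * pd 1 u z) (u1.mul u1) p0 (pd_cs cφ 0) 0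
  have d := jac (v := pd 1 u) (w := fun z => pd 0 u z * φ z) u1 (u0.mul hφ1) (pd_cs cu 1)
    cφ.mul_left 0 1
  simp only [pd_mul u0 u1, pd_mul u0 u0, pd_mul u1 u1, pd_mul u0 hφ1] at a b c d
  have C : ∀ i j, Continuous (pd i (pd j u)) := fun i j => pd_cont (pd_c1 hu j) i
  have C' : ∀ i j, Continuous (pd i (pd j φ)) := fun i j => pd_cont (pd_c1 hφ j) i
  have Cu : ∀ i, Continuous (pd i u) := fun i => (pd_c1 hu i).continuous
  have Cp : ∀ i, Continuous (pd i φ) := fun i => (pd_c1 hφ i).continuous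
  have Cp0 := hφ.continuous
  have S : ∀ i j, HasCompactSupport (pd i (pd j φ)) := fun i j => pd_cs (pd_cs cφ j) i
  have S1 : ∀ i, HasCompactSupport (pd i φ) := fun i => (pd_cs cφ i)
  have I : ∀ f g : E2 → ℝ, Continuous f → Continuous g → HasCompactSupport g →
    Integrable (fun x => f x * g x) := fun f g hf hg hc =>
      (hf.mul hg).integrable_of_hasCompactSupport hc.mul_left
  have I1 : Integrable (fun x => pd 0 u x * pd 1 u x * pd 1 (pd 0 φ) x) :=
    I _ _ (by fun_prop) (by fun_prop) (S _ _)
  have I2 : Integrable (fun x => pd 0 u x * pd 0 u x * pd 1 (pd 1 φ) x) :=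
    I _ _ (by fun_prop) (by fun_prop) (S _ _)
  have I3 : Integrable (fun x => pd 1 u x * pd 1 u x * pd 0 (pd 0 φ) x) :=
    I _ _ (by fun_prop) (by fun_prop) (S _ _)
  have J1 : Integrable (fun x => (pd 1 (pd 0 u) x * pd 1 u x + pd 0 u x * pd 1 (pd 1 u) x)
    * pd 0 φ x) := I _ _ (by fun_prop) (by fun_prop) (S1 _)
  have J2 : Integrable (fun x => (pd 1 (pd 0 u) x * pd 0 u x + pd 0 u x * pd 1 (pd 0 u) x)
    * pd 1 φ x) := I _ _ (by fun_prop) (by fun_prop) (S1 _)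
  have J3 : Integrable (fun x => (pd 0 (pd 1 u) x * pd 1 u x + pd 1 u x * pd 0 (pd 1 u) x)
    * pd 0 φ x) := I _ _ (by fun_prop) (by fun_prop) (S1 _)
  have K1 : Integrable (fun x => pd 1 (pd 1 u) x * (pd 0 (pd 0 u) x * φ x + pd 0 u x * pd 0 φ x)) :=
    (by fun_prop : Continuous _).integrable_of_hasCompactSupport
      ((cφ.mul_left.add (S1 0).mul_left).mul_left)
  have K2 : Integrable (fun x => pd 0 (pd 1 u) x * (pd 1 (pd 0 u) x * φ x + pd 0 u x * pd 1 φ x)) :=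
    (by fun_prop : Continuous _).integrable_of_hasCompactSupport
      ((cφ.mul_left.add (S1 1).mul_left).mul_left)
  have lhs : ∫ x, (pd 0 u x * pd 1 u x * hess φ x 0 1 - (1/2) * (pd 0 u x * pd 0 u x) * hess φ x 1 1
      - (1/2) * (pd 1 u x * pd 1 u x) * hess φ x 0 0)
      = (∫ x, pd 0 u x * pd 1 u x * pd 1 (pd 0 φ) x)
        - (1/2) * (∫ x, pd 0 u x * pd 0 u x * pd 1 (pd 1 φ) x)
        - (1/2) * ∫ x, pd 1 u x * pd 1 u x * pd 0 (pd 0 φ) x := by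
    rw [lin3 (F := fun x => pd 0 u x * pd 1 u x * hess φ x 0 1
      - (1/2) * (pd 0 u x * pd 0 u x) * hess φ x 1 1
      - (1/2) * (pd 1 u x * pd 1 u x) * hess φ x 0 0) 1 (-1/2) (-1/2) I1 I2 I3 ?_]
    · ring
    · intro x
      simp only [hess, Matrix.of_apply]
      rw [pd_symm hφ 0 1]; ring
  have r1 := lin3 _ (-1) (1/2) (1/2) J1 J2 J3 (fun x => rfl)
  have J := (((J1.const_mul (-1)).add (J2.const_mul (1/2))).add (J3.const_mul (1/2)))
  have r2 := lin3 (fun x => φ x * (hess u x).det) 1 1 (-1) J K1 K2 (by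
    intro x
    simp only [hess, Matrix.det_fin_two, Matrix.of_apply, Pi.add_apply]
    rw [pd_symm hu 0 1]; ring)
  simp only [Pi.add_apply] at r2
  rw [lhs, a, b, c, r2, r1, d]
  ring

def PP (r θ : ℝ) : E2 := !₂[r * cos θ, r * sin θ]

lemma polarE2 (f : E2 → ℝ) : ∫ x, f x =
    ∫ p in Set.Ioi (0:ℝ) ×ˢ Set.Ioo (-π) π, p.1 * f (PP p.1 p.2) := by
  have h1 := (EuclideanSpace.volume_preserving_symm_measurableEquiv_toLp (Fin 2)).symm
  have h2 := (volume_preserving_finTwoArrow ℝ).symm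
  rw [← h1.integral_comp (MeasurableEquiv.measurableEmbedding _),
    ← h2.integral_comp (MeasurableEquiv.measurableEmbedding _), ← integral_comp_polarCoord_symm]
  rfl

lemma intg (A : ℝ × ℝ → ℝ) (hc : Continuous A) (h0 : ∀ r θ, 1 ≤ r → A (r, θ) = 0) :
    IntegrableOn A (Set.Ioi (0:ℝ) ×ˢ Set.Ioo (-π) π) := by
  have h : IntegrableOn A (Set.Icc (0:ℝ) 1 ×ˢ Set.Icc (-π) π) :=
    hc.continuousOn.integrableOn_compact (isCompact_Icc.prod isCompact_Icc)
  apply h.of_forall_sdiff_eq_zero (measurableSet_Ioi.prod measurableSet_Ioo)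
  rintro ⟨r, θ⟩ ⟨⟨h1, h2⟩, h3⟩
  apply h0
  by_contra hr
  exact h3 ⟨⟨le_of_lt h1, by linarith⟩, ⟨h2.1.le, h2.2.le⟩⟩

lemma PP_norm (r θ : ℝ) (hr : 0 ≤ r) : ‖PP r θ‖ = r := by
  rw [EuclideanSpace.norm_eq, Real.sqrt_eq_iff_mul_self_eq (by positivity) hr]
  simp [PP, Fin.sum_univ_two]
  nlinarith [sin_sq_add_cos_sq θ]

lemma PP_eq (r θ : ℝ) : PP r θ = (r * cos θ) • e2 0 + (r * sin θ) • e2 1 := by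
  ext i; fin_cases i <;> simp [PP, e2]

lemma PP_cont : Continuous (fun p : ℝ × ℝ => PP p.1 p.2) := by
  simp only [PP_eq]; fun_prop

lemma deriv_r {f : E2 → ℝ} (hf : ContDiff ℝ 1 f) (r θ : ℝ) :
    HasDerivAt (fun r => f (PP r θ)) (cos θ * pd 0 f (PP r θ) + sin θ * pd 1 f (PP r θ)) r := by
  have h1 : HasDerivAt (fun r => PP r θ) ((1 * cos θ) • e2 0 + (1 * sin θ) • e2 1) r := by
    simp only [PP_eq]
    exact (((hasDerivAt_id r).mul_const (cos θ)).smul_const _).add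
      (((hasDerivAt_id r).mul_const (sin θ)).smul_const _)
  have h2 := (hf.differentiable (by norm_num) (PP r θ)).hasFDerivAt.comp_hasDerivAt r h1
  refine h2.congr_deriv ?_
  simp [pd]

lemma deriv_t {f : E2 → ℝ} (hf : ContDiff ℝ 1 f) (r θ : ℝ) :
    HasDerivAt (fun θ => f (PP r θ))
      (-(r * sin θ) * pd 0 f (PP r θ) + (r * cos θ) * pd 1 f (PP r θ)) θ := by
  have h1 : HasDerivAt (fun θ => PP r θ) ((r * -sin θ) • e2 0 + (r * cos θ) • e2 1) θ := by
    simp only [PP_eq]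
    exact (((hasDerivAt_cos θ).const_mul r).smul_const _).add
      (((hasDerivAt_sin θ).const_mul r).smul_const _)
  have h2 := (hf.differentiable (by norm_num) (PP r θ)).hasFDerivAt.comp_hasDerivAt θ h1
  refine h2.congr_deriv ?_
  simp [pd]

/-- tangential second derivative -/
def TT (Φ : E2 → ℝ) (x : E2) : ℝ :=
  (x 1 * x 1 * hess Φ x 0 0 - 2 * (x 0 * x 1) * hess Φ x 0 1 + x 0 * x 0 * hess Φ x 1 1) / ‖x‖ ^ 2

lemma int_TT {Φ : E2 → ℝ} (hΦ : ContDiff ℝ 2 Φ) (hs : tsupport Φ ⊆ ball (0 : E2) 1) :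
    ∫ x, TT Φ x = - (2 * π) * Φ 0 := by
  have p0 := pd_c1 hΦ 0
  have p1 := pd_c1 hΦ 1
  have hΦ1 : ContDiff ℝ 1 Φ := hΦ.of_le (by norm_num)
  have C : ∀ i j, Continuous (pd i (pd j Φ)) := fun i j => pd_cont (pd_c1 hΦ j) i
  have Cp : ∀ i, Continuous (pd i Φ) := fun i => (pd_c1 hΦ i).continuous
  have zero : ∀ f : E2 → ℝ, tsupport f ⊆ tsupport Φ → ∀ r θ, 1 ≤ r → f (PP r θ) = 0 := by
    intro f hf r θ hr
    apply image_eq_zero_of_notMem_tsupport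
    intro h
    have := hs (hf h)
    rw [mem_ball_zero_iff, PP_norm r θ (by linarith)] at this
    linarith
  have z0 := zero Φ le_rfl
  have z1 : ∀ i, ∀ r θ, 1 ≤ r → pd i Φ (PP r θ) = 0 := fun i => zero _ (pd_tsupport _ i)
  have z2 : ∀ i j, ∀ r θ, 1 ≤ r → pd i (pd j Φ) (PP r θ) = 0 := fun i j =>
    zero _ ((pd_tsupport _ i).trans (pd_tsupport _ j))
  let A : ℝ × ℝ → ℝ := fun p => cos p.2 * pd 0 Φ (PP p.1 p.2) + sin p.2 * pd 1 Φ (PP p.1 p.2)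
  let B : ℝ × ℝ → ℝ := fun p => - (cos p.2 * pd 0 Φ (PP p.1 p.2) + sin p.2 * pd 1 Φ (PP p.1 p.2))
    + p.1 * (sin p.2 ^ 2 * pd 0 (pd 0 Φ) (PP p.1 p.2)
      - 2 * (sin p.2 * cos p.2) * pd 0 (pd 1 Φ) (PP p.1 p.2)
      + cos p.2 ^ 2 * pd 1 (pd 1 Φ) (PP p.1 p.2))
  have cA : Continuous A := by
    have := PP_cont
    simp only [A]; fun_prop
  have cB : Continuous B := by
    have := PP_cont
    simp only [B]; fun_prop
  have iA := intg A cA (by intro r θ hr; simp [A, z1 _ r θ hr])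
  have iB := intg B cB (by intro r θ hr; simp [B, z1 _ r θ hr, z2 _ _ r θ hr])
  have split : ∫ x, TT Φ x = ∫ p in Set.Ioi (0:ℝ) ×ˢ Set.Ioo (-π) π, (A p + B p) := by
    rw [polarE2]
    apply setIntegral_congr_fun (measurableSet_Ioi.prod measurableSet_Ioo)
    rintro ⟨r, θ⟩ ⟨hr, -⟩
    have hr : 0 < r := hr
    simp only [TT, PP_norm r θ hr.le, A, B, hess, Matrix.of_apply]
    have x0 : PP r θ 0 = r * cos θ := rfl
    have x1 : PP r θ 1 = r * sin θ := rfl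
    rw [x0, x1]
    field_simp
    ring
  have hB : ∫ p in Set.Ioi (0:ℝ) ×ˢ Set.Ioo (-π) π, B p = 0 := by
    rw [Measure.volume_eq_prod, setIntegral_prod _ iB]
    have : ∀ r : ℝ, ∫ θ in Set.Ioo (-π) π, B (r, θ) = 0 := by
      intro r
      rw [← integral_Ioc_eq_integral_Ioo,
        ← intervalIntegral.integral_of_le (by linarith [pi_pos])]
      have hd : ∀ θ ∈ Set.uIcc (-π) π, HasDerivAt
          (fun θ => -sin θ * pd 0 Φ (PP r θ) + cos θ * pd 1 Φ (PP r θ)) (B (r, θ)) θ := by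
        intro θ _
        have h := ((hasDerivAt_sin θ).neg.mul (deriv_t p0 r θ)).add
          ((hasDerivAt_cos θ).mul (deriv_t p1 r θ))
        refine h.congr_deriv ?_
        simp only [B, pd_symm hΦ 1 0, Pi.neg_apply]
        ring
      rw [intervalIntegral.integral_eq_sub_of_hasDerivAt hd
        ((cB.comp (by fun_prop : Continuous fun θ : ℝ => (r, θ))).intervalIntegrable _ _)]
      simp [PP]
    simp [this]
  have hA : ∫ p in Set.Ioi (0:ℝ) ×ˢ Set.Ioo (-π) π, A p = - (2 * π) * Φ 0 := by
    rw [Measure.volume_eq_prod, ← setIntegral_prod_swap, setIntegral_prod]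
    · have : ∀ θ : ℝ, ∫ r in Set.Ioi (0:ℝ), A (r, θ) = - Φ 0 := by
        intro θ
        have hz : ∀ r, 1 ≤ r → A (r, θ) = 0 := by intro r hr; simp [A, z1 _ r θ hr]
        have h1 : ∫ r in Set.Ioi (0:ℝ), A (r, θ) = ∫ r in Set.Ioc (0:ℝ) 1, A (r, θ) := by
          apply setIntegral_eq_of_subset_of_forall_sdiff_eq_zero measurableSet_Ioi
          · exact Set.Ioc_subset_Ioi_self
          · rintro r ⟨h, h'⟩
            apply hz
            by_contra hr
            exact h' ⟨h, by linarith⟩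
        rw [h1, ← intervalIntegral.integral_of_le (by norm_num)]
        rw [intervalIntegral.integral_eq_sub_of_hasDerivAt (fun r _ => deriv_r hΦ1 r θ)
          ((cA.comp (by fun_prop : Continuous fun r : ℝ => (r, θ))).intervalIntegrable _ _)]
        rw [z0 1 θ le_rfl]
        have : PP 0 θ = 0 := by simp [PP_eq]
        rw [this]; ring
      simp only [Prod.swap_prod_mk, this]
      simp
      rw [max_eq_left (by linarith [pi_pos])]
      left; ring
    · exact iA.swap
  rw [split, integral_add iA iB, hA, hB, add_zero]

lemma coord_bd (x : E2) (i j : Fin 2) : |x i * x j| / ‖x‖ ^ 2 ≤ 1 := by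
  apply div_le_one_of_le₀ _ (by positivity)
  rw [abs_mul, sq]
  have h : ∀ k : Fin 2, |x k| ≤ ‖x‖ := fun k => by
    simpa using PiLp.norm_apply_le x k
  exact mul_le_mul (h i) (h j) (abs_nonneg _) (norm_nonneg _)

lemma hess_cont {Φ : E2 → ℝ} (hΦ : ContDiff ℝ 2 Φ) (i j : Fin 2) :
    Continuous (fun x => hess Φ x i j) := pd_cont (pd_c1 hΦ j) i

lemma hess_cs {Φ : E2 → ℝ} (cΦ : HasCompactSupport Φ) (i j : Fin 2) :
    HasCompactSupport (fun x => hess Φ x i j) := pd_cs (pd_cs cΦ j) i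

lemma hess_zero {Φ : E2 → ℝ} (i j : Fin 2) {x : E2} (hx : x ∉ tsupport Φ) :
    hess Φ x i j = 0 :=
  image_eq_zero_of_notMem_tsupport (f := pd i (pd j Φ))
    (fun h => hx (pd_tsupport _ j (pd_tsupport _ i h)))

lemma TT_int {Φ : E2 → ℝ} (hΦ : ContDiff ℝ 2 Φ) (cΦ : HasCompactSupport Φ) :
    Integrable (TT Φ) := by
  have I : ∀ i j, Integrable (fun x => hess Φ x i j) := fun i j =>
    (hess_cont hΦ i j).integrable_of_hasCompactSupport (hess_cs cΦ i j)
  have key : ∀ i j k l, Integrable (fun x : E2 => (x i * x j) / ‖x‖ ^ 2 * hess Φ x k l) := by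
    intro i j k l
    apply (I k l).mono
    · apply Measurable.aestronglyMeasurable
      have := (hess_cont hΦ k l).measurable
      fun_prop
    · filter_upwards with x
      rw [norm_mul, norm_div, Real.norm_eq_abs (x i * x j), norm_pow, norm_norm]
      exact mul_le_of_le_one_left (norm_nonneg _) (coord_bd x i j)
  have h := ((key 1 1 0 0).sub ((key 0 1 0 1).const_mul 2)).add (key 0 0 1 1)
  refine h.congr ?_
  filter_upwards with x
  simp only [TT, Pi.add_apply, Pi.sub_apply]
  ring

lemma part2 (Δ : ℝ) (y : E2 → E3)
    (hiso : ∀ x ∈ ball (0 : E2) 1 \ {0}, gmet y x = gDelta Δ x) :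
    ∀ Φ : E2 → ℝ, ContDiff ℝ 2 Φ → HasCompactSupport Φ →
      tsupport Φ ⊆ ball (0 : E2) 1 →
      ∫ x in ball (0 : E2) 1,
          (gmet y x 0 1 * hess Φ x 0 1
            - (1 / 2) * gmet y x 0 0 * hess Φ x 1 1
            - (1 / 2) * gmet y x 1 1 * hess Φ x 0 0)
        = π * Δ ^ 2 * Φ 0 := by
  intro Φ hΦ cΦ hs
  have I : ∀ i j, Integrable (fun x => hess Φ x i j) := fun i j =>
    (hess_cont hΦ i j).integrable_of_hasCompactSupport (hess_cs cΦ i j)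
  have Z : ∀ i, ∫ x, hess Φ x i i = 0 := fun i => int_pd (pd_c1 hΦ i) (pd_cs cΦ i) i
  let G : E2 → ℝ := fun x => (-(1 - Δ ^ 2) / 2) * hess Φ x 0 0 + (-(1 - Δ ^ 2) / 2) * hess Φ x 1 1
    + (-(Δ ^ 2) / 2) * TT Φ x
  have e1 : ∫ x in ball (0 : E2) 1,
          (gmet y x 0 1 * hess Φ x 0 1
            - (1 / 2) * gmet y x 0 0 * hess Φ x 1 1
            - (1 / 2) * gmet y x 1 1 * hess Φ x 0 0) = ∫ x in ball (0 : E2) 1, G x := by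
    apply setIntegral_congr_ae measurableSet_ball
    have : ∀ᵐ x : E2, x ≠ 0 := by
      simp [ae_iff]
    filter_upwards [this] with x hx hxb
    rw [hiso x ⟨hxb, hx⟩]
    have hn : ‖x‖ ≠ 0 := by simpa using hx
    have hn2 : ‖x‖ ^ 2 = x 0 ^ 2 + x 1 ^ 2 := by
      rw [EuclideanSpace.norm_sq_eq]; simp [Fin.sum_univ_two]
    have hn3 : x 0 ^ 2 + x 1 ^ 2 ≠ 0 := by rw [← hn2]; positivity
    simp only [G, TT, gDelta, perpVec, hn2, Matrix.sub_apply, Matrix.of_apply, Matrix.one_apply,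
      Matrix.cons_val_zero, Matrix.cons_val_one]
    simp
    field_simp
    ring
  have e2 : ∫ x in ball (0 : E2) 1, G x = ∫ x, G x := by
    apply setIntegral_eq_integral_of_forall_compl_eq_zero
    intro x hx
    have hx' : x ∉ tsupport Φ := fun h => hx (hs h)
    simp [G, TT, hess_zero _ _ hx']
  rw [e1, e2, lin3 G _ _ _ (I 0 0) (I 1 1) (TT_int hΦ cΦ) (fun x => rfl), Z, Z, int_TT hΦ hs]
  ring

lemma pd_congr {f g : E2 → ℝ} {x : E2} (h : f =ᶠ[𝓝 x] g) (i : Fin 2) :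
    pd i f =ᶠ[𝓝 x] pd i g := by
  filter_upwards [h.fderiv (𝕜 := ℝ)] with z hz
  simp [pd, hz]

lemma part1 (y : E2 → E3) {c : ℝ}
    (hy : ContDiffOn ℝ 2 y (ball (0 : E2) 1 \ {0}))
    (P2 : ∀ Φ : E2 → ℝ, ContDiff ℝ 2 Φ → HasCompactSupport Φ →
      tsupport Φ ⊆ ball (0 : E2) 1 →
      ∫ x in ball (0 : E2) 1,
          (gmet y x 0 1 * hess Φ x 0 1
            - (1 / 2) * gmet y x 0 0 * hess Φ x 1 1
            - (1 / 2) * gmet y x 1 1 * hess Φ x 0 0)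
        = c * Φ 0) :
    ∀ x ∈ ball (0 : E2) 1 \ {0}, ∑ i : Fin 3, (hess (fun z => y z i) x).det = 0 := by
  intro x₀ hx₀
  have hU : IsOpen (ball (0 : E2) 1 \ {0}) := isOpen_ball.sdiff isClosed_singleton
  obtain ⟨ε, hε, hεU⟩ := Metric.isOpen_iff.1 hU x₀ hx₀
  let χ : ContDiffBump x₀ := ⟨ε / 3, ε / 2, by positivity, by linarith⟩
  have hχU : tsupport χ ⊆ ball (0 : E2) 1 \ {0} := by
    rw [χ.tsupport_eq]
    exact (closedBall_subset_ball (by simp only [χ]; linarith)).trans hεU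
  let u : Fin 3 → E2 → ℝ := fun i z => χ z * y z i
  have hu : ∀ i, ContDiff ℝ 2 (u i) := by
    intro i
    rw [contDiff_iff_contDiffAt]
    intro x
    by_cases hx : x ∈ tsupport (u i)
    swap
    · have : u i =ᶠ[𝓝 x] fun _ => 0 := notMem_tsupport_iff_eventuallyEq.1 hx
      exact contDiffAt_const.congr_of_eventuallyEq this
    have hxU : x ∈ ball (0 : E2) 1 \ {0} := hχU (tsupport_mul_subset_left hx)
    have h1 : ContDiffAt ℝ 2 y x := hy.contDiffAt (hU.mem_nhds hxU)
    have h2 : ContDiffAt ℝ 2 (fun z => y z i) x := by fun_prop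
    exact χ.contDiffAt.mul h2
  have cu : ∀ i, HasCompactSupport (u i) := fun i => χ.hasCompactSupport.mul_right
  set V := ball x₀ (ε / 3) with hV
  have hVU : V ⊆ ball (0 : E2) 1 \ {0} := (ball_subset_ball (by linarith)).trans hεU
  have hloc : ∀ x ∈ V, ∀ i, u i =ᶠ[𝓝 x] fun z => y z i := by
    intro x hx i
    have : χ =ᶠ[𝓝 x] 1 := χ.eventuallyEq_one_of_mem_ball hx
    filter_upwards [this] with z hz
    simp [u, hz]
  have hdet : ∀ x ∈ V, ∀ i, hess (u i) x = hess (fun z => y z i) x := by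
    intro x hx i
    ext a b
    exact (pd_congr (pd_congr (hloc x hx i) b) a).eq_of_nhds
  have hg : ∀ x ∈ V, ∀ a b, gmet y x a b = ∑ i, pd a (u i) x * pd b (u i) x := by
    intro x hx a b
    simp only [gmet, Matrix.mul_apply, Matrix.transpose_apply, Dmat, Matrix.of_apply]
    apply Finset.sum_congr rfl
    intro i _
    rw [(pd_congr (hloc x hx i) a).eq_of_nhds, (pd_congr (hloc x hx i) b).eq_of_nhds]
  have cdet : ∀ i, Continuous (fun x => (hess (u i) x).det) := by
    intro i
    simp only [Matrix.det_fin_two]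
    have := hess_cont (hu i)
    exact ((this 0 0).mul (this 1 1)).sub ((this 0 1).mul (this 1 0))
  have csum : Continuous (fun x => ∑ i, (hess (u i) x).det) :=
    continuous_finsetSum _ (fun i _ => cdet i)
  have hae := isOpen_ball.ae_eq_zero_of_integral_contDiff_smul_eq_zero (U := V) (μ := volume)
    (f := fun x => ∑ i, (hess (u i) x).det) (csum.locallyIntegrable.locallyIntegrableOn _) (by
      intro φ hφ cφ sφ
      have hφ : ContDiff ℝ 2 φ := contDiff_infty.1 hφ 2
      have h := P2 φ hφ cφ (sφ.trans (hVU.trans Set.sdiff_subset))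
      have h0 : φ 0 = 0 := image_eq_zero_of_notMem_tsupport (fun h => (hVU (sφ h)).2 rfl)
      rw [h0, mul_zero, setIntegral_eq_integral_of_forall_compl_eq_zero] at h
      · have w := fun i => weakdet (hu i) (cu i) hφ cφ
        have Iw : ∀ i, Integrable (fun x => pd 0 (u i) x * pd 1 (u i) x * hess φ x 0 1
            - (1/2) * (pd 0 (u i) x * pd 0 (u i) x) * hess φ x 1 1
            - (1/2) * (pd 1 (u i) x * pd 1 (u i) x) * hess φ x 0 0) := by
          intro i
          have C : ∀ a, Continuous (pd a (u i)) := fun a => (pd_c1 (hu i) a).continuous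
          have I : ∀ (f : E2 → ℝ) a b, Continuous f → Integrable (fun x => f x * hess φ x a b) :=
            fun f a b hf => (hf.mul (hess_cont hφ a b)).integrable_of_hasCompactSupport
              (hess_cs cφ a b).mul_left
          exact ((I _ 0 1 (by fun_prop)).sub (I _ 1 1 (by fun_prop))).sub (I _ 0 0 (by fun_prop))
        have Id : ∀ i, Integrable (fun x => φ x * (hess (u i) x).det) := fun i =>
          (hφ.continuous.mul (cdet i)).integrable_of_hasCompactSupport cφ.mul_right
        have s1 : ∫ x, φ x • ∑ i, (hess (u i) x).det = ∑ i, ∫ x, φ x * (hess (u i) x).det := by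
          rw [← integral_finsetSum _ (fun i _ => Id i)]
          simp only [smul_eq_mul, Finset.mul_sum]
        rw [s1, ← Finset.sum_congr rfl (fun i _ => w i), ← integral_finsetSum _ (fun i _ => Iw i),
          ← h]
        congr 1; ext x
        by_cases hx : x ∈ tsupport φ
        · simp only [hg x (sφ hx), Fin.sum_univ_three]
          ring
        · simp [hess_zero _ _ hx]
      · intro x hx
        have hx' : x ∉ tsupport φ := fun h => hx (hVU (sφ h)).1
        simp [hess_zero _ _ hx'])
  have hx₀V : x₀ ∈ V := mem_ball_self (by positivity)
  have := Measure.eqOn_open_of_ae_eq (f := fun x => ∑ i, (hess (u i) x).det) (g := fun _ => 0)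
    ((ae_restrict_iff' measurableSet_ball).2 hae) isOpen_ball csum.continuousOn
    continuousOn_const hx₀V
  simpa [hdet x₀ hx₀V] using this

/-- an exact isometric immersion of the cone metric has vanishing
Hessian determinant sum away from the origin, and its distributional Hessian
determinant sum equals `πΔ²δ₀`. -/
theorem stmt_12 (Δ : ℝ) (hΔ0 : 0 < Δ) (hΔ1 : Δ < 1) (y : E2 → E3)
    (hy : ContDiffOn ℝ 2 y (ball (0 : E2) 1 \ {0}))
    (hlip : ∃ K : NNReal, LipschitzOnWith K y (ball (0 : E2) 1))
    (hiso : ∀ x ∈ ball (0 : E2) 1 \ {0}, gmet y x = gDelta Δ x) :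
    (∀ x ∈ ball (0 : E2) 1 \ {0}, ∑ i : Fin 3, (hess (fun z => y z i) x).det = 0) ∧
    (∀ Φ : E2 → ℝ, ContDiff ℝ 2 Φ → HasCompactSupport Φ →
      tsupport Φ ⊆ ball (0 : E2) 1 →
      ∫ x in ball (0 : E2) 1,
          (gmet y x 0 1 * hess Φ x 0 1
            - (1 / 2) * gmet y x 0 0 * hess Φ x 1 1
            - (1 / 2) * gmet y x 1 1 * hess Φ x 0 0)
        = π * Δ ^ 2 * Φ 0) := by
  have P2 := part2 Δ y hiso
  refine ⟨?_, P2⟩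
  exact part1 y hy P2
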